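/- Let G be a group and H a subgroup of finite index in G. If H is finitely generated and has polynomial growth, then G is finitely generated and has polynomial growth. -/

import Mathlib

open scoped BigOperators

/-- The ball of radius `n` in a group `G` with respect to a set `S`:
elements expressible as a product of at most `n` elements of `S`. -/
def ball {G : Type*} [Group G] (S : Set G) (n : ℕ) : Set G :=
  {g | ∃ l : List G, (∀ x ∈ l, x ∈ S) ∧ l.length ≤ n ∧ l.prod = g}

/-- The growth function of `G` relative to `S`: `γ_S(n) = |B_S(n)|`. -/
noncomputable def growth {G : Type*} [Group G] (S : Set G) (n : ℕ) : ℕ := (ball S n).ncard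

/-- A finite symmetric generating set of `G`. -/
def IsSymmGen {G : Type*} [Group G] (S : Finset G) : Prop :=
  (∀ x ∈ S, x⁻¹ ∈ S) ∧ Subgroup.closure (S : Set G) = ⊤

/-- `G` has polynomial growth: for some finite symmetric generating set `S`
there are `C > 0` and `k : ℕ` with `γ_S(n) ≤ C * n ^ k` for all `n ≥ 1`. -/
def HasPolyGrowth (G : Type*) [Group G] : Prop :=
  ∃ S : Finset G, IsSymmGen S ∧ ∃ C : ℝ, 0 < C ∧ ∃ k : ℕ,
    ∀ n : ℕ, 1 ≤ n → (growth (S : Set G) n : ℝ) ≤ C * (n : ℝ) ^ k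

theorem ball_mono {G : Type*} [Group G] (S : Set G) : Monotone (ball S) := by
  rintro m n hmn g ⟨l, hl, hlen, rfl⟩
  exact ⟨l, hl, hlen.trans hmn, rfl⟩

theorem mul_mem_ball {G : Type*} [Group G] {S : Set G} {m n : ℕ} {a b : G}
    (ha : a ∈ ball S m) (hb : b ∈ ball S n) : a * b ∈ ball S (m + n) := by
  obtain ⟨l, hl, hlen, rfl⟩ := ha
  obtain ⟨l', hl', hlen', rfl⟩ := hb
  refine ⟨l ++ l', fun x hx => ?_, by simpa using Nat.add_le_add hlen hlen', List.prod_append⟩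
  exact (List.mem_append.mp hx).elim (hl x) (hl' x)

theorem finite_ball {G : Type*} [Group G] {S : Set G} (hS : S.Finite) (n : ℕ) :
    (ball S n).Finite := by
  have : Finite S := hS
  refine ((List.finite_length_le S n).image fun l => (l.map Subtype.val).prod).subset ?_
  rintro g ⟨l, hl, hlen, rfl⟩
  lift l to List S using hl
  exact ⟨l, by simpa using hlen, rfl⟩

theorem IsSymmGen.exists_mem_ball {G : Type*} [Group G] {S : Finset G} (hS : IsSymmGen S)
    (g : G) : ∃ n, g ∈ ball (S : Set G) n := by
  have hg : g ∈ (Subgroup.closure (S : Set G)).toSubmonoid := hS.2 ▸ Subgroup.mem_top g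
  rw [Subgroup.closure_toSubmonoid] at hg
  obtain ⟨l, hl, rfl⟩ := Submonoid.exists_list_of_mem_closure hg
  refine ⟨l.length, l, fun x hx => ?_, le_rfl, rfl⟩
  exact (hl x hx).elim id fun h => by simpa using hS.1 _ h

theorem IsSymmGen.exists_forall_mem_ball {G ι : Type*} [Group G] [Finite ι] {S : Finset G}
    (hS : IsSymmGen S) (f : ι → G) : ∃ n, ∀ i, f i ∈ ball (S : Set G) n := by
  choose N hN using fun i => hS.exists_mem_ball (f i)
  obtain ⟨n, hn⟩ := (Set.finite_range N).bddAbove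
  exact ⟨n, fun i => ball_mono _ (hn ⟨i, rfl⟩) (hN i)⟩

theorem Subgroup.exists_eq_out_mul {G : Type*} [Group G] (H : Subgroup G) (g : G) :
    ∃ h : H, g = (g : G ⧸ H).out * h := by
  obtain ⟨h, hh⟩ := QuotientGroup.mk_out_eq_mul H g
  exact ⟨h⁻¹, by simp [hh]⟩

/-- A finite symmetric generating set of a finite-index subgroup, enlarged by coset
representatives and their inverses, generates the whole group. -/
theorem IsSymmGen.exists_of_finiteIndex {G : Type*} [Group G] {H : Subgroup G} [H.FiniteIndex]
    {S : Finset H} (hS : IsSymmGen S) : ∃ U : Finset G, IsSymmGen U := by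
  classical
  have := Fintype.ofFinite (G ⧸ H)
  let R : Finset G := Finset.univ.image (Quotient.out : G ⧸ H → G)
  let U : Finset G := S.image (↑) ∪ (R ∪ R.image (·⁻¹))
  refine ⟨U, fun x hx => ?_, eq_top_iff.mpr fun g _ => ?_⟩
  · rw [Finset.mem_union, Finset.mem_union, Finset.mem_image,
      Finset.mem_image (s := R)] at hx ⊢
    rcases hx with ⟨h, hh, rfl⟩ | hx | ⟨r, hr, rfl⟩
    · exact Or.inl ⟨h⁻¹, hS.1 h hh, rfl⟩
    · exact Or.inr (Or.inr ⟨x, hx, rfl⟩)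
    · exact Or.inr (Or.inl (by rwa [inv_inv]))
  · obtain ⟨h, hg⟩ := H.exists_eq_out_mul g
    rw [hg]
    refine mul_mem (Subgroup.subset_closure (by simp [U, R])) ?_
    have hmem : (h : G) ∈ (Subgroup.closure (S : Set H)).map H.subtype :=
      ⟨h, hS.2 ▸ Subgroup.mem_top h, rfl⟩
    rw [MonoidHom.map_closure] at hmem
    exact Subgroup.closure_mono (by simp [U]) hmem

/-- Words in a finite set of elements of `G` are coset representatives times elements of `H` of
linearly bounded word length. -/
theorem exists_ball_subset_image {G : Type*} [Group G] {H : Subgroup G} [H.FiniteIndex]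
    {S : Finset H} (hS : IsSymmGen S) (U : Finset G) :
    ∃ m, ∀ n, ball (U : Set G) n ⊆ (fun p : (G ⧸ H) × H => p.1.out * (p.2 : G)) ''
      (Set.univ ×ˢ ball (S : Set H) (m * (n + 1))) := by
  choose c hc using H.exists_eq_out_mul
  obtain ⟨a, ha⟩ := hS.exists_mem_ball (c 1)
  obtain ⟨b, hb⟩ := hS.exists_forall_mem_ball fun p : U × (G ⧸ H) => c (p.1 * p.2.out)
  refine ⟨a + b, fun n => ?_⟩
  suffices key : ∀ l : List G, (∀ x ∈ l, x ∈ U) →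
      ∃ q : G ⧸ H, ∃ h ∈ ball (S : Set H) (a + b * l.length), q.out * (h : G) = l.prod by
    rintro g ⟨l, hl, hlen, rfl⟩
    obtain ⟨q, h, hh, hq⟩ := key l hl
    exact ⟨(q, h), ⟨Set.mem_univ _, ball_mono _ (by nlinarith) hh⟩, hq⟩
  intro l
  induction l with
  | nil => exact fun _ => ⟨_, c 1, by simpa using ha, by simpa using (hc 1).symm⟩
  | cons u l ih =>
    intro hl
    obtain ⟨q, h, hh, hq⟩ := ih fun x hx => hl x (List.mem_cons_of_mem _ hx)
    refine ⟨(u * q.out : G), c (u * q.out) * h,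
      ball_mono _ ?_ (mul_mem_ball (hb (⟨u, hl u List.mem_cons_self⟩, q)) hh), ?_⟩
    · rw [List.length_cons]
      linarith
    · rw [Subgroup.coe_mul, ← mul_assoc, ← hc, mul_assoc, hq, List.prod_cons]

theorem exists_growth_le {G : Type*} [Group G] {H : Subgroup G} [H.FiniteIndex]
    {S : Finset H} (hS : IsSymmGen S) (U : Finset G) :
    ∃ m, ∀ n, growth (U : Set G) n ≤ H.index * growth (S : Set H) (m * (n + 1)) := by
  obtain ⟨m, hm⟩ := exists_ball_subset_image hS U
  refine ⟨m, fun n => ?_⟩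
  have hfin : (Set.univ ×ˢ ball (S : Set H) (m * (n + 1)) : Set ((G ⧸ H) × H)).Finite :=
    Set.finite_univ.prod (finite_ball S.finite_toSet _)
  calc growth (U : Set G) n ≤ _ := Set.ncard_le_ncard (hm n) (hfin.image _)
    _ ≤ _ := Set.ncard_image_le hfin
    _ = _ := by rw [Set.ncard_prod, Set.ncard_univ]; rfl

/-- If `H` is a finite-index subgroup of `G` which is finitely generated and has
polynomial growth, then `G` is finitely generated and has polynomial growth. -/
theorem stmt6 {G : Type*} [Group G] (H : Subgroup G) (hind : H.FiniteIndex)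
    (hfg : Group.FG H) (hpg : HasPolyGrowth H) :
    Group.FG G ∧ HasPolyGrowth G := by
  obtain ⟨S, hS, C, hC, k, hgrowth⟩ := hpg
  obtain ⟨U, hU⟩ := hS.exists_of_finiteIndex
  obtain ⟨m, hm⟩ := exists_growth_le hS U
  refine ⟨⟨U, hU.2⟩, U, hU, (H.index + 1) * (C * (2 * (m + 1)) ^ k), by positivity, k,
    fun n hn => ?_⟩
  have hmono : growth (S : Set H) (m * (n + 1)) ≤ growth (S : Set H) (2 * (m + 1) * n) :=
    Set.ncard_le_ncard (ball_mono _ (by nlinarith)) (finite_ball S.finite_toSet _)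
  have hpoly := hgrowth (2 * (m + 1) * n) (by nlinarith)
  calc (growth (U : Set G) n : ℝ)
      ≤ H.index * growth (S : Set H) (2 * (m + 1) * n) :=
        mod_cast (hm n).trans (Nat.mul_le_mul_left _ hmono)
    _ ≤ (H.index + 1) * (C * ((2 * (m + 1) * n : ℕ) : ℝ) ^ k) := by
        gcongr
        linarith
    _ = (H.index + 1) * (C * (2 * (m + 1)) ^ k) * (n : ℝ) ^ k := by
        push_cast
        rw [mul_pow _ (n : ℝ)]
        ring
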